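/- For each n let Σ_n = (r_{n,i,j})_{i,j∈𝓘_n} be a symmetric matrix with |r_{n,i,j}| ≤ 1, and define G_n(t) = max_{i∈𝓘_n} Σ_{j∈𝓘_n} 1{|r_{n,i,j}| > t} and γ(n,b) = sup_{i∈𝓘_n} sup_{𝓐⊂𝓘_n, |𝓐|=b} inf_{j∈𝓐} |r_{n,i,j}|. Then γ(n,b_n)·(log b_n) = o(1) for every sequence b_n → ∞ if and only if G_n(t_n) = exp{o(1/t_n)} for every positive sequence (t_n) converging to zero. -/

import Mathlib

open Filter Asymptotics

/-- `G_n(t) = max_{i ∈ 𝓘ₙ} #{j ∈ 𝓘ₙ : |r_{n,i,j}| > t}`. -/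
noncomputable def Gfun (s : ℕ → ℕ) (r : ∀ n, Fin (s n) → Fin (s n) → ℝ)
    (n : ℕ) (t : ℝ) : ℕ :=
  Finset.univ.sup fun i : Fin (s n) =>
    (Finset.univ.filter fun j : Fin (s n) => t < |r n i j|).card

/-- `γ(n,b) = sup_{i ∈ 𝓘ₙ} sup_{𝓐 ⊆ 𝓘ₙ, |𝓐| = b} inf_{j ∈ 𝓐} |r_{n,i,j}|`. -/
noncomputable def gammafun (s : ℕ → ℕ) (r : ∀ n, Fin (s n) → Fin (s n) → ℝ)
    (n : ℕ) (b : ℕ) : ℝ :=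
  sSup {x : ℝ | ∃ i : Fin (s n), ∃ 𝓐 : Finset (Fin (s n)), 𝓐.card = b ∧
    x = sInf ((fun j => |r n i j|) '' (𝓐 : Set (Fin (s n))))}

/-- A row with at least `Gfun s r n t` entries above `t` witnesses `t ≤ gammafun`. -/
theorem le_gammafun_Gfun {s : ℕ → ℕ} {r : ∀ n, Fin (s n) → Fin (s n) → ℝ}
    (hbdd : ∀ n i j, |r n i j| ≤ 1) {n : ℕ} {t : ℝ} (hG : 0 < Gfun s r n t) :
    t ≤ gammafun s r n (Gfun s r n t) := by
  have hne : (Finset.univ : Finset (Fin (s n))).Nonempty := by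
    by_contra h
    rw [Finset.not_nonempty_iff_eq_empty] at h
    simp [Gfun, h] at hG
  obtain ⟨i, -, hi⟩ := Finset.exists_mem_eq_sup _ hne
    fun i : Fin (s n) => (Finset.univ.filter fun j : Fin (s n) => t < |r n i j|).card
  change Gfun s r n t = _ at hi
  set A := Finset.univ.filter fun j : Fin (s n) => t < |r n i j| with hA
  have hAne : A.Nonempty := Finset.card_pos.mp (hi ▸ hG)
  have hle : t ≤ sInf ((fun j => |r n i j|) '' (A : Set (Fin (s n)))) := by
    refine le_csInf (Set.Nonempty.image _ (by simpa using hAne)) ?_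
    rintro _ ⟨j, hj, rfl⟩
    have : t < |r n i j| := by simpa [hA] using hj
    exact this.le
  refine hle.trans (le_csSup ⟨1, ?_⟩ ⟨i, A, hi.symm, rfl⟩)
  rintro _ ⟨k, B, -, rfl⟩
  rcases B.eq_empty_or_nonempty with rfl | ⟨j, hj⟩
  · simp
  · refine (csInf_le ⟨0, ?_⟩ (Set.mem_image_of_mem _ hj)).trans (hbdd n k j)
    rintro _ ⟨l, -, rfl⟩
    exact abs_nonneg _

/-- If every row has fewer than `b` entries above `t ≥ 0`, then `gammafun s r n b ≤ t`. -/
theorem gammafun_le_of_Gfun_lt {s : ℕ → ℕ} {r : ∀ n, Fin (s n) → Fin (s n) → ℝ}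
    {n b : ℕ} {t : ℝ} (ht : 0 ≤ t) (hG : Gfun s r n t < b) : gammafun s r n b ≤ t := by
  refine Real.sSup_le ?_ ht
  rintro _ ⟨i, A, hA, rfl⟩
  obtain ⟨j, hj, hjt⟩ : ∃ j ∈ A, |r n i j| ≤ t := by
    by_contra! h
    have h1 : A.card ≤ (Finset.univ.filter fun j : Fin (s n) => t < |r n i j|).card :=
      Finset.card_le_card fun j hj => by simpa using h j hj
    have h2 : (Finset.univ.filter fun j : Fin (s n) => t < |r n i j|).card ≤ Gfun s r n t :=
      Finset.le_sup (f := fun i : Fin (s n) =>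
        (Finset.univ.filter fun j : Fin (s n) => t < |r n i j|).card) (Finset.mem_univ i)
    omega
  refine (csInf_le ⟨0, ?_⟩ (Set.mem_image_of_mem _ hj)).trans hjt
  rintro _ ⟨l, -, rfl⟩
  exact abs_nonneg _

theorem gammafun_nonneg (s : ℕ → ℕ) (r : ∀ n, Fin (s n) → Fin (s n) → ℝ) (n b : ℕ) :
    0 ≤ gammafun s r n b := by
  refine Real.sSup_nonneg ?_
  rintro _ ⟨i, A, -, rfl⟩
  refine Real.sInf_nonneg ?_
  rintro _ ⟨l, -, rfl⟩
  exact abs_nonneg _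

/-- For each `n`, let `Σ_n = (r_{n,i,j})` be a symmetric matrix with `|r_{n,i,j}| ≤ 1`, indexed
by a finite set `𝓘ₙ` with `|𝓘ₙ| = s_n → ∞`.  Then `γ(n, b_n) · log b_n = o(1)` for every
sequence `b_n → ∞` if and only if `G_n(t_n) = exp{o(1/t_n)}` (i.e. `log G_n(t_n) = o(1/t_n)`)
for every positive sequence `(t_n)` converging to zero. -/
theorem gamma_log_littleO_iff_G_subexp
    (s : ℕ → ℕ) (hs : Tendsto s atTop atTop)
    (r : ∀ n, Fin (s n) → Fin (s n) → ℝ)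
    (hsymm : ∀ n i j, r n i j = r n j i)
    (hbdd : ∀ n i j, |r n i j| ≤ 1) :
    (∀ b : ℕ → ℕ, Tendsto b atTop atTop →
        Tendsto (fun n => gammafun s r n (b n) * Real.log (b n)) atTop (nhds 0))
      ↔ (∀ t : ℕ → ℝ, (∀ n, 0 < t n) → Tendsto t atTop (nhds 0) →
          (fun n => Real.log (Gfun s r n (t n))) =o[atTop] (fun n => 1 / t n)) := by
  constructor
  · intro h t ht ht0
    rw [isLittleO_iff]
    intro c hc
    let b : ℕ → ℕ := fun n => if c / t n < Real.log (Gfun s r n (t n)) then Gfun s r n (t n) else n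
    have hinv : Tendsto (fun n => c / t n) atTop atTop := by
      have h0 : Tendsto t atTop (nhdsWithin 0 (Set.Ioi 0)) :=
        tendsto_nhdsWithin_iff.mpr ⟨ht0, Eventually.of_forall ht⟩
      simpa only [div_eq_mul_inv, Function.comp_apply] using (tendsto_inv_nhdsGT_zero.comp h0).const_mul_atTop hc
    have hb : Tendsto b atTop atTop := by
      rw [tendsto_atTop]
      intro m
      filter_upwards [eventually_ge_atTop m, hinv.eventually_ge_atTop (m : ℝ)] with n hn hmn
      simp only [b]
      split_ifs with hlog
      · have h1 := Real.log_le_self (Nat.cast_nonneg (α := ℝ) (Gfun s r n (t n)))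
        exact_mod_cast (by linarith : (m : ℝ) ≤ Gfun s r n (t n))
      · exact hn
    filter_upwards [(h b hb).eventually_lt_const hc] with n hn
    rw [Real.norm_of_nonneg (Real.log_natCast_nonneg _),
      Real.norm_of_nonneg (one_div_nonneg.mpr (ht n).le), mul_one_div]
    by_contra! hlog
    simp only [b, if_pos hlog] at hn
    have hpos : 0 < Real.log (Gfun s r n (t n)) := (div_pos hc (ht n)).trans hlog
    have hG : 0 < Gfun s r n (t n) := by
      rw [Nat.pos_iff_ne_zero]
      intro h0
      simp [h0] at hpos
    have hle := mul_le_mul_of_nonneg_right (le_gammafun_Gfun hbdd hG) hpos.le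
    rw [div_lt_iff₀' (ht n)] at hlog
    linarith
  · intro h b hb
    have hlogb : Tendsto (fun n => Real.log (b n)) atTop atTop :=
      Real.tendsto_log_atTop.comp (tendsto_natCast_atTop_atTop.comp hb)
    rw [Metric.tendsto_nhds]
    intro ε hε
    let t : ℕ → ℝ := fun n => ε / 2 / max 1 (Real.log (b n))
    have hmax : ∀ n, 0 < max 1 (Real.log (b n)) := fun n => lt_max_of_lt_left one_pos
    have ht : ∀ n, 0 < t n := fun n => div_pos (half_pos hε) (hmax n)
    have ht0 : Tendsto t atTop (nhds 0) :=
      (tendsto_atTop_mono (fun n => le_max_right _ _) hlogb).const_div_atTop _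
    filter_upwards [(isLittleO_iff.mp (h t ht ht0)) (c := ε / 4) (by positivity),
      hlogb.eventually_ge_atTop 1, hb.eventually_gt_atTop 0] with n hn hlog hbn
    have htn : t n = ε / 2 / Real.log (b n) := by simp only [t, max_eq_right hlog]
    have hlog0 : 0 < Real.log (b n) := one_pos.trans_le hlog
    have hG : Gfun s r n (t n) < b n := by
      by_contra! hle
      have hle' : Real.log (b n) ≤ Real.log (Gfun s r n (t n)) :=
        Real.log_le_log (by exact_mod_cast hbn) (by exact_mod_cast hle)
      rw [Real.norm_of_nonneg (Real.log_natCast_nonneg _),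
        Real.norm_of_nonneg (one_div_nonneg.mpr (ht n).le)] at hn
      have heq : ε / 4 * (1 / t n) = Real.log (b n) / 2 := by
        rw [htn]
        field_simp
        norm_num
      linarith
    have hle := mul_le_mul_of_nonneg_right (gammafun_le_of_Gfun_lt (ht n).le hG) hlog0.le
    have heq : t n * Real.log (b n) = ε / 2 := by
      rw [htn]
      field_simp
    rw [Real.dist_0_eq_abs, abs_of_nonneg (mul_nonneg (gammafun_nonneg s r n _) hlog0.le)]
    linarith
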